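/- Let t ∈ ℝ satisfy c̄₀^t < e^{P̄(t)} and c̄₁^t < e^{P̄(t)}. Then Q̄(t) = P̄(t). -/

import Mathlib

open Filter

/-- The weight `c_ω` of a word `ω` over the alphabet `{0,1}` (here `false` is the
letter 0 and `true` is the letter 1): the product of `c0` over letters 0 and `c1`
over letters 1. -/
noncomputable def wt (c0 c1 : ℝ) (w : List Bool) : ℝ :=
  (w.map fun b => if b then c1 else c0).prod

/-- All words of length `n` over the alphabet `{0,1}`. -/
def allWords : ℕ → Finset (List Bool)
  | 0 => {[]}
  | n + 1 => (allWords n).biUnion fun w => {false :: w, true :: w}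

/-- Membership in the language of the S-gap shift: every maximal block of 0s lying
strictly between two 1s has length in `S`. -/
def InLang (S : Set ℕ) (w : List Bool) : Prop :=
  ∀ u v : List Bool, ∀ m : ℕ,
    w = u ++ [true] ++ List.replicate m false ++ [true] ++ v → m ∈ S

/-- Membership in the core set `G`: words of the form `0^{s₁}1 0^{s₂}1 ⋯ 0^{s_k}1`
with `k ≥ 1` and every `s_i ∈ S`. -/
def InCore (S : Set ℕ) (w : List Bool) : Prop :=
  ∃ bs : List ℕ, bs ≠ [] ∧ (∀ s ∈ bs, s ∈ S) ∧
    w = (bs.map fun s => List.replicate s false ++ [true]).flatten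

/-- `L_n`: the words of length `n` in the language of the S-gap shift. -/
noncomputable def langWords (S : Set ℕ) (n : ℕ) : Finset (List Bool) :=
  @Finset.filter _ (InLang S) (Classical.decPred _) (allWords n)

/-- `G_n`: the core words of length `n`. -/
noncomputable def coreWords (S : Set ℕ) (n : ℕ) : Finset (List Bool) :=
  @Finset.filter _ (InCore S) (Classical.decPred _) (allWords n)

/-- Extended-real logarithm with `log 0 = -∞`. -/
noncomputable def elog (x : ℝ) : EReal := if x = 0 then ⊥ else ((Real.log x : ℝ) : EReal)

/-- `Q(t) = limsup_{n → ∞} (1/n) log (∑_{ω ∈ G_n} c_ω^t)`, taken in the extended reals. -/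
noncomputable def Qfun (S : Set ℕ) (c0 c1 : ℝ) (t : ℝ) : EReal :=
  limsup (fun n : ℕ =>
    ((1 / (n : ℝ) : ℝ) : EReal) * elog (∑ ω ∈ coreWords S n, wt c0 c1 ω ^ t)) atTop

/-- Concatenations of (possibly no) blocks `0^s 1` with `s ∈ S`. -/
def IsBlockWord (S : Set ℕ) (w : List Bool) : Prop :=
  ∃ bs : List ℕ, (∀ s ∈ bs, s ∈ S) ∧
    w = (bs.map fun s => List.replicate s false ++ [true]).flatten

lemma isBlockWord_nil (S : Set ℕ) : IsBlockWord S [] := ⟨[], by simp, rfl⟩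

lemma IsBlockWord.cons {S : Set ℕ} {w : List Bool} (hw : IsBlockWord S w) {s : ℕ} (hs : s ∈ S) :
    IsBlockWord S (List.replicate s false ++ true :: w) := by
  obtain ⟨bs, hbs, rfl⟩ := hw
  exact ⟨s :: bs, by simpa using ⟨hs, hbs⟩, by simp⟩

lemma IsBlockWord.eq_nil_or_inCore {S : Set ℕ} {w : List Bool} (hw : IsBlockWord S w) :
    w = [] ∨ InCore S w := by
  obtain ⟨bs, hbs, rfl⟩ := hw
  rcases eq_or_ne bs [] with rfl | h
  · exact Or.inl rfl
  · exact Or.inr ⟨bs, h, hbs, rfl⟩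

lemma replicate_append_true_eq_append_true {s : ℕ} {x y u : List Bool}
    (h : List.replicate s false ++ true :: x = u ++ true :: y) :
    (u = List.replicate s false ∧ x = y) ∨ ∃ u', x = u' ++ true :: y := by
  induction s generalizing u with
  | zero =>
    cases u with
    | nil => simp_all
    | cons c u => exact Or.inr ⟨u, by simp_all⟩
  | succ s ih =>
    cases u with
    | nil => simp [List.replicate_succ] at h
    | cons c u =>
      simp only [List.replicate_succ, List.cons_append, List.cons.injEq] at h
      rcases ih h.2 with ⟨hu, hx⟩ | h'
      · exact Or.inl ⟨by rw [hu, ← h.1, List.replicate_succ], hx⟩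
      · exact Or.inr h'

lemma replicate_append_true_inj {s m : ℕ} {x y : List Bool}
    (h : List.replicate s false ++ true :: x = List.replicate m false ++ true :: y) : s = m := by
  induction s generalizing m with
  | zero => cases m <;> simp_all [List.replicate_succ]
  | succ s ih =>
    cases m with
    | zero => simp [List.replicate_succ] at h
    | succ m =>
      simp only [List.replicate_succ, List.cons_append, List.cons.injEq, true_and] at h
      rw [ih h]

lemma InCore.inLang {S : Set ℕ} {w : List Bool} (hw : InCore S w) : InLang S w := by
  obtain ⟨bs, -, hbs, rfl⟩ := hw
  intro u v m h
  induction bs generalizing u with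
  | nil => simp at h
  | cons s bs ih =>
    have hbs' : ∀ s ∈ bs, s ∈ S := fun s hs => hbs s (List.mem_cons_of_mem _ hs)
    simp only [List.map_cons, List.flatten_cons, List.append_assoc, List.singleton_append] at h
    rcases replicate_append_true_eq_append_true h with ⟨-, hx⟩ | ⟨u', hu'⟩
    · cases bs with
      | nil => simp at hx
      | cons s' bs =>
        simp only [List.map_cons, List.flatten_cons, List.append_assoc,
          List.singleton_append] at hx
        exact replicate_append_true_inj hx ▸ hbs' s' (by simp)
    · exact ih hbs' u' (by simpa using hu')

lemma eq_replicate_or_eq_append_true (w : List Bool) :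
    w = List.replicate w.length false ∨
      ∃ s x, w = List.replicate s false ++ true :: x := by
  induction w with
  | nil => simp
  | cons c w ih =>
    cases c with
    | true => exact Or.inr ⟨0, w, by simp⟩
    | false =>
      rcases ih with h | ⟨s, x, h⟩
      · left
        rw [List.length_cons, List.replicate_succ, ← h]
      · exact Or.inr ⟨s + 1, x, by simp [h, List.replicate_succ]⟩

lemma InLang.of_append {S : Set ℕ} {p w : List Bool} (h : InLang S (p ++ w)) : InLang S w :=
  fun u v m hw => h (p ++ u) v m (by simp [hw])

lemma InLang.exists_blockWord {S : Set ℕ} {w : List Bool} (h : InLang S (true :: w)) :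
    ∃ x j, IsBlockWord S x ∧ w = x ++ List.replicate j false := by
  induction hn : w.length using Nat.strong_induction_on generalizing w with
  | _ n ih =>
    rcases eq_replicate_or_eq_append_true w with hw | ⟨s, w', rfl⟩
    · exact ⟨[], w.length, isBlockWord_nil S, by simpa using hw⟩
    · have hs : s ∈ S := h [] w' s (by simp)
      have h' : InLang S (true :: w') :=
        InLang.of_append (p := true :: List.replicate s false) (by simpa using h)
      obtain ⟨x, j, hx, rfl⟩ := ih w'.length (by simp at hn; omega) h' rfl
      exact ⟨_, j, hx.cons hs, by simp⟩

lemma mem_allWords {n : ℕ} {w : List Bool} : w ∈ allWords n ↔ w.length = n := by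
  induction n generalizing w with
  | zero => simp [allWords]
  | succ n ih =>
    cases w with
    | nil => simp [allWords]
    | cons c w => cases c <;> simp [allWords, ih]

lemma mem_langWords {S : Set ℕ} {n : ℕ} {w : List Bool} :
    w ∈ langWords S n ↔ w.length = n ∧ InLang S w := by
  simp [langWords, mem_allWords]

lemma mem_coreWords {S : Set ℕ} {n : ℕ} {w : List Bool} :
    w ∈ coreWords S n ↔ w.length = n ∧ InCore S w := by
  simp [coreWords, mem_allWords]

lemma coreWords_subset_langWords (S : Set ℕ) (n : ℕ) : coreWords S n ⊆ langWords S n := by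
  intro w hw
  rw [mem_coreWords] at hw
  exact mem_langWords.2 ⟨hw.1, hw.2.inLang⟩

lemma replicate_false_mem_langWords (S : Set ℕ) (n : ℕ) :
    List.replicate n false ∈ langWords S n := by
  refine mem_langWords.2 ⟨by simp, fun u v m h => ?_⟩
  have : true ∈ List.replicate n false := by rw [h]; simp
  simp at this

lemma wt_append (a b : ℝ) (u v : List Bool) : wt a b (u ++ v) = wt a b u * wt a b v := by
  simp [wt]

lemma wt_true_cons (a b : ℝ) (w : List Bool) : wt a b (true :: w) = b * wt a b w := by
  simp [wt]

lemma wt_replicate_false (a b : ℝ) (n : ℕ) : wt a b (List.replicate n false) = a ^ n := by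
  simp [wt]

lemma wt_pos {a b : ℝ} (ha : 0 < a) (hb : 0 < b) (w : List Bool) : 0 < wt a b w := by
  refine List.prod_pos ?_
  simp only [List.mem_map]
  rintro _ ⟨c, -, rfl⟩
  split_ifs <;> assumption

lemma wt_rpow {a b : ℝ} (ha : 0 < a) (hb : 0 < b) (t : ℝ) (w : List Bool) :
    wt a b w ^ t = wt (a ^ t) (b ^ t) w := by
  induction w with
  | nil => simp [wt]
  | cons c w ih =>
    have hw := (wt_pos ha hb w).le
    have h : wt a b (c :: w) = (if c then b else a) * wt a b w := by simp [wt]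
    rw [h, Real.mul_rpow (by split_ifs <;> positivity) hw, ih]
    cases c <;> simp [wt]

/-- Every word of the language is `0^n` or of the form `0^i 1 x 0^j` with `x` empty or a core
word. -/
lemma langWords_subset (S : Set ℕ) (n : ℕ) :
    langWords S n ⊆ insert (List.replicate n false)
      (((Finset.range n ×ˢ Finset.range n).filter fun p => p.1 + p.2 + 1 ≤ n).biUnion
        fun p => (insert [] (coreWords S p.2)).image
          fun x => List.replicate p.1 false ++ true :: (x ++
            List.replicate (n - 1 - p.1 - x.length) false)) := by
  intro w hw
  obtain ⟨rfl, hL⟩ := mem_langWords.1 hw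
  rcases eq_replicate_or_eq_append_true w with h | ⟨i, w', rfl⟩
  · exact Finset.mem_insert.2 (Or.inl h)
  · obtain ⟨x, j, hx, rfl⟩ := hL.of_append.exists_blockWord
    refine Finset.mem_insert_of_mem (Finset.mem_biUnion.2 ⟨(i, x.length), ?_, ?_⟩)
    · simp
      omega
    · refine Finset.mem_image.2 ⟨x, ?_, ?_⟩
      · rcases hx.eq_nil_or_inCore with rfl | h
        · simp
        · exact Finset.mem_insert_of_mem (mem_coreWords.2 ⟨rfl, h⟩)
      · simp

lemma sum_biUnion_le_sum {ι α : Type*} [DecidableEq α] (s : Finset ι) (f : ι → Finset α)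
    {g : α → ℝ} (hg : ∀ x, 0 ≤ g x) :
    ∑ x ∈ s.biUnion f, g x ≤ ∑ i ∈ s, ∑ x ∈ f i, g x := by
  classical
  induction s using Finset.induction_on with
  | empty => simp
  | insert i s hi ih =>
    rw [Finset.biUnion_insert, Finset.sum_insert hi]
    have h := Finset.sum_union_inter (s₁ := f i) (s₂ := s.biUnion f) (f := g)
    have h' : 0 ≤ ∑ x ∈ f i ∩ s.biUnion f, g x := Finset.sum_nonneg fun x _ => hg x
    linarith

lemma sum_image_le_sum {α β : Type*} [DecidableEq β] (s : Finset α) (f : α → β)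
    {g : β → ℝ} (hg : ∀ x, 0 ≤ g x) :
    ∑ y ∈ s.image f, g y ≤ ∑ x ∈ s, g (f x) := by
  classical
  have h : s.image f = s.biUnion fun x => {f x} := by ext; simp [eq_comm]
  rw [h]
  simpa using sum_biUnion_le_sum s (fun x => {f x}) hg

/-- If the core sums grow at most like `r ^ n`, then so do the language sums, up to a
polynomial factor. -/
lemma sum_langWords_le {S : Set ℕ} {a b r C : ℝ} (ha : 0 < a) (hb : 0 < b) (har : a ≤ r)
    (hC : 0 ≤ C) (hg : ∀ n, ∑ x ∈ coreWords S n, wt a b x ≤ C * r ^ n) (n : ℕ) :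
    ∑ w ∈ langWords S n, wt a b w ≤ (1 + b * (1 + C) / r) * ((n : ℝ) + 1) ^ 2 * r ^ n := by
  have hr : 0 < r := ha.trans_le har
  have hw : ∀ w, 0 ≤ wt a b w := fun w => (wt_pos ha hb w).le
  have term (i m : ℕ) (him : i + m + 1 ≤ n) :
      ∑ x ∈ insert [] (coreWords S m), wt a b (List.replicate i false ++ true :: (x ++
            List.replicate (n - 1 - i - x.length) false)) ≤ b * (1 + C) / r * r ^ n := by
    have hone : wt a b (List.replicate i false ++ true :: ([] ++
        List.replicate (n - 1 - i - ([] : List Bool).length) false)) ≤ b / r * r ^ n := by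
      rw [wt_append, wt_true_cons, wt_append, wt_replicate_false, wt_replicate_false]
      have h : a ^ i * a ^ (n - 1 - i) ≤ r ^ (n - 1) := by
        rw [← pow_add, show i + (n - 1 - i) = n - 1 by omega]
        gcongr
      have hn : r ^ n = r ^ (n - 1) * r := by rw [← pow_succ]; congr 1; omega
      calc _ = b * (a ^ i * a ^ (n - 1 - i)) := by simp [wt]; ring
        _ ≤ b * r ^ (n - 1) := by gcongr
        _ = _ := by rw [hn]; field_simp
    have hrest : ∑ x ∈ coreWords S m, wt a b (List.replicate i false ++ true :: (x ++
        List.replicate (n - 1 - i - x.length) false)) ≤ b * C / r * r ^ n := by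
      have heq : ∀ x ∈ coreWords S m, wt a b (List.replicate i false ++ true :: (x ++
          List.replicate (n - 1 - i - x.length) false)) =
          b * a ^ (n - 1 - m) * wt a b x := by
        intro x hx
        obtain ⟨rfl, -⟩ := mem_coreWords.1 hx
        rw [wt_append, wt_true_cons, wt_append, wt_replicate_false, wt_replicate_false,
          show n - 1 - x.length = i + (n - 1 - i - x.length) by omega, pow_add]
        ring
      rw [Finset.sum_congr rfl heq, ← Finset.mul_sum]
      have hn : r ^ n = r ^ (n - 1 - m) * r ^ m * r := by
        rw [← pow_add, ← pow_succ]; congr 1; omega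
      calc _ ≤ b * r ^ (n - 1 - m) * (C * r ^ m) := by
            gcongr
            · exact Finset.sum_nonneg fun x _ => hw x
            · exact hg m
        _ = _ := by rw [hn]; field_simp
    have hun := Finset.sum_union_inter (s₁ := {[]}) (s₂ := coreWords S m)
      (f := fun x => wt a b (List.replicate i false ++ true :: (x ++
        List.replicate (n - 1 - i - x.length) false)))
    have hin : 0 ≤ ∑ x ∈ {[]} ∩ coreWords S m, wt a b (List.replicate i false ++ true :: (x ++
        List.replicate (n - 1 - i - x.length) false)) := Finset.sum_nonneg fun x _ => hw _
    rw [Finset.sum_singleton] at hun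
    rw [Finset.insert_eq]
    have : b * (1 + C) / r * r ^ n = b / r * r ^ n + b * C / r * r ^ n := by ring
    linarith
  set F := (Finset.range n ×ˢ Finset.range n).filter fun p => p.1 + p.2 + 1 ≤ n with hF
  set K := b * (1 + C) / r with hK
  have hKpos : 0 ≤ K := by positivity
  have hcard : (F.card : ℝ) ≤ (n : ℝ) ^ 2 := by
    have : F.card ≤ n ^ 2 := (Finset.card_filter_le _ _).trans (by simp [sq])
    exact_mod_cast this
  have hmain : ∑ w ∈ langWords S n, wt a b w ≤ r ^ n + F.card * (K * r ^ n) := by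
    refine (Finset.sum_le_sum_of_subset_of_nonneg (langWords_subset S n)
      fun w _ _ => hw w).trans ?_
    rw [Finset.insert_eq]
    refine (le_add_of_nonneg_right (Finset.sum_nonneg fun w _ => hw w)).trans
      (Finset.sum_union_inter.le.trans ?_)
    rw [Finset.sum_singleton, wt_replicate_false]
    gcongr
    refine (sum_biUnion_le_sum _ _ hw).trans ?_
    rw [← nsmul_eq_mul]
    refine Finset.sum_le_card_nsmul _ _ _ fun p hp => ?_
    exact (sum_image_le_sum _ _ hw).trans (term p.1 p.2 (Finset.mem_filter.1 hp).2)
  have hn0 : (0 : ℝ) ≤ n := n.cast_nonneg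
  calc _ ≤ r ^ n + F.card * (K * r ^ n) := hmain
    _ ≤ r ^ n + (n : ℝ) ^ 2 * (K * r ^ n) := by gcongr
    _ = (1 + K * (n : ℝ) ^ 2) * r ^ n := by ring
    _ ≤ _ := by
      gcongr
      nlinarith [mul_nonneg hKpos hn0]

lemma exists_forall_le_mul_pow {g : ℕ → ℝ} {r : ℝ} (hr : 0 < r) (hg : ∀ n, 0 ≤ g n)
    (h : ∀ᶠ n in atTop, g n ≤ r ^ n) : ∃ C, 0 ≤ C ∧ ∀ n, g n ≤ C * r ^ n := by
  obtain ⟨N, hN⟩ := eventually_atTop.1 h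
  have hnn : ∀ m ∈ Finset.range N, 0 ≤ g m / r ^ m :=
    fun m _ => div_nonneg (hg m) (by positivity)
  refine ⟨1 + ∑ m ∈ Finset.range N, g m / r ^ m,
    add_nonneg zero_le_one (Finset.sum_nonneg hnn), fun n => ?_⟩
  rcases le_or_gt N n with hn | hn
  · refine (hN n hn).trans (le_mul_of_one_le_left (by positivity) ?_)
    linarith [Finset.sum_nonneg hnn]
  · rw [← div_le_iff₀ (by positivity)]
    linarith [Finset.single_le_sum hnn (Finset.mem_range.2 hn)]

/-- A sequence bounded by `K (n + 1)² rⁿ` has exponential growth rate at most `log r`. -/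
lemma le_log_of_tendsto {f : ℕ → ℝ} {K r p : ℝ} (hK : 0 < K) (hr : 0 < r) (hf : ∀ n, 0 < f n)
    (hle : ∀ n, f n ≤ K * ((n : ℝ) + 1) ^ 2 * r ^ n)
    (hp : Tendsto (fun n : ℕ => (1 / (n : ℝ)) * Real.log (f n)) atTop (nhds p)) :
    p ≤ Real.log r := by
  have h1 : Tendsto (fun n : ℕ => Real.log ((n : ℝ) + 1) / ((n : ℝ) + 1) * (((n : ℝ) + 1) / n))
      atTop (nhds (0 * 1)) := by
    refine Tendsto.mul ?_ ?_
    · have h := (Real.isLittleO_log_id_atTop.tendsto_div_nhds_zero).comp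
        (tendsto_atTop_add_const_right atTop (1 : ℝ) tendsto_natCast_atTop_atTop)
      exact h
    · have h : Tendsto (fun n : ℕ => 1 + 1 / (n : ℝ)) atTop (nhds (1 + 0)) :=
        tendsto_const_nhds.add tendsto_one_div_atTop_nhds_zero_nat
      rw [add_zero] at h
      refine h.congr' ?_
      filter_upwards [eventually_gt_atTop 0] with n hn
      have : (n : ℝ) ≠ 0 := by positivity
      field_simp
  have h2 : Tendsto (fun n : ℕ => (1 / (n : ℝ)) * Real.log K +
      2 * (Real.log ((n : ℝ) + 1) / ((n : ℝ) + 1) * (((n : ℝ) + 1) / n)) + Real.log r)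
      atTop (nhds (0 * Real.log K + 2 * (0 * 1) + Real.log r)) :=
    ((tendsto_one_div_atTop_nhds_zero_nat.mul_const _).add (h1.const_mul 2)).add_const _
  have h3 : p ≤ 0 * Real.log K + 2 * (0 * 1) + Real.log r := by
    refine le_of_tendsto_of_tendsto hp h2 ?_
    filter_upwards [eventually_gt_atTop 0] with n hn
    have hn' : (0 : ℝ) < n := by exact_mod_cast hn
    have hlog : Real.log (f n) ≤ Real.log K + 2 * Real.log ((n : ℝ) + 1) + n * Real.log r := by
      refine (Real.log_le_log (hf n) (hle n)).trans_eq ?_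
      rw [Real.log_mul (by positivity) (by positivity), Real.log_mul (by positivity)
        (by positivity), Real.log_pow, Real.log_pow]
      norm_num
    calc (1 / (n : ℝ)) * Real.log (f n) ≤
        (1 / (n : ℝ)) * (Real.log K + 2 * Real.log ((n : ℝ) + 1) + n * Real.log r) := by gcongr
      _ = _ := by field_simp
  simpa using h3

lemma elog_le_log {x y : ℝ} (hx : 0 ≤ x) (hxy : x ≤ y) : elog x ≤ (Real.log y : ℝ) := by
  unfold elog
  split_ifs with h
  · exact bot_le
  · exact EReal.coe_le_coe_iff.2 (Real.log_le_log (lt_of_le_of_ne hx (Ne.symm h)) hxy)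

lemma le_exp_pow_of_elog_lt {x q : ℝ} (hx : 0 ≤ x) {n : ℕ} (hn : 0 < n)
    (h : ((1 / (n : ℝ) : ℝ) : EReal) * elog x < (q : EReal)) : x ≤ Real.exp q ^ n := by
  rcases hx.eq_or_lt with rfl | hx
  · positivity
  · have hn' : (0 : ℝ) < n := by exact_mod_cast hn
    rw [elog, if_neg hx.ne', ← EReal.coe_mul, EReal.coe_lt_coe_iff, one_div, inv_mul_lt_iff₀ hn']
      at h
    rw [← Real.exp_nat_mul]
    exact (Real.log_le_iff_le_exp hx).1 h.le

/-- If c̄₀^t < e^{P̄(t)} and c̄₁^t < e^{P̄(t)}, then Q̄(t) = P̄(t). -/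
theorem stmt7
    (S : Set ℕ) (hS : S.Infinite)
    (c0 c1 cb0 cb1 : ℝ)
    (hc0 : 0 < c0) (hc0b : c0 ≤ cb0) (hcb0 : cb0 < 1)
    (hc1 : 0 < c1) (hc1b : c1 ≤ cb1) (hcb1 : cb1 < 1)
    (P Pb : ℝ → ℝ)
    (hP : ∀ t : ℝ, Filter.Tendsto
      (fun n : ℕ => (1 / (n : ℝ)) * Real.log (∑ ω ∈ langWords S n, wt c0 c1 ω ^ t))
      Filter.atTop (nhds (P t)))
    (hPb : ∀ t : ℝ, Filter.Tendsto
      (fun n : ℕ => (1 / (n : ℝ)) * Real.log (∑ ω ∈ langWords S n, wt cb0 cb1 ω ^ t))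
      Filter.atTop (nhds (Pb t)))
    (t : ℝ) (ht0 : cb0 ^ t < Real.exp (Pb t)) (ht1 : cb1 ^ t < Real.exp (Pb t)) :
    Qfun S cb0 cb1 t = (Pb t : EReal) := by
  set a := cb0 ^ t with ha_def
  set b := cb1 ^ t with hb_def
  have hcb0' : 0 < cb0 := hc0.trans_le hc0b
  have hcb1' : 0 < cb1 := hc1.trans_le hc1b
  have ha : 0 < a := Real.rpow_pos_of_pos hcb0' t
  have hb : 0 < b := Real.rpow_pos_of_pos hcb1' t
  have hlim := hPb t
  simp only [Qfun, wt_rpow hcb0' hcb1', ← ha_def, ← hb_def] at hlim ⊢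
  have hw : ∀ w, 0 ≤ wt a b w := fun w => (wt_pos ha hb w).le
  have hcore : ∀ n, 0 ≤ ∑ ω ∈ coreWords S n, wt a b ω :=
    fun n => Finset.sum_nonneg fun w _ => hw w
  have hlang : ∀ n, 0 < ∑ ω ∈ langWords S n, wt a b ω := fun n =>
    Finset.sum_pos (fun w _ => wt_pos ha hb w) ⟨_, replicate_false_mem_langWords S n⟩
  apply le_antisymm
  · have hE := (continuous_coe_real_ereal.tendsto (Pb t)).comp hlim
    rw [← hE.limsup_eq]
    refine limsup_le_limsup (Eventually.of_forall fun n => ?_)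
    simp only [Function.comp_apply, EReal.coe_mul]
    exact mul_le_mul_of_nonneg_left (elog_le_log (hcore n)
      (Finset.sum_le_sum_of_subset_of_nonneg (coreWords_subset_langWords S n)
        fun w _ _ => hw w)) (by exact_mod_cast (by positivity : (0 : ℝ) ≤ 1 / (n : ℝ)))
  · by_contra! hlt
    have hloga : ((Real.log a : ℝ) : EReal) < Pb t :=
      EReal.coe_lt_coe_iff.2 ((Real.log_lt_iff_lt_exp ha).2 ht0)
    obtain ⟨q, hq, hqP⟩ := EReal.lt_iff_exists_real_btwn.1 (max_lt hlt hloga)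
    have haq : a ≤ Real.exp q := (Real.log_le_iff_le_exp ha).1
      (EReal.coe_lt_coe_iff.1 ((le_max_right _ _).trans_lt hq)).le
    have hev := eventually_lt_of_limsup_lt ((le_max_left _ _).trans_lt hq)
    obtain ⟨C, hC, hCle⟩ := exists_forall_le_mul_pow (Real.exp_pos q) hcore (by
      filter_upwards [hev, eventually_gt_atTop 0] with n hn hn0
      exact le_exp_pow_of_elog_lt (hcore n) hn0 hn)
    have hle := le_log_of_tendsto (by positivity) (Real.exp_pos q) hlang
      (sum_langWords_le ha hb haq hC hCle) hlim
    rw [Real.log_exp] at hle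
    exact absurd (EReal.coe_lt_coe_iff.1 hqP) hle.not_gt
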